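/- Let (G,q) be a nondegenerate metric group and H an isotropic subgroup, and let q̄ be the induced quadratic form on H^⊥/H defined by q̄(gH) = q(g). Then the Gauss sums satisfy ∑_{x ∈ H^⊥/H} q̄(x) = |H|⁻¹ · ∑_{g∈G} q(g). In particular, since |H^⊥/H| = |G|/|H|², the central charge τ⁺/√|·| of (H^⊥/H, q̄) equals that of (G,q). -/

import Mathlib

/-- The bimultiplicative form associated to a quadratic form `q` on a group:
`b(g,h) = q(g*h) * q(g)⁻¹ * q(h)⁻¹`. -/
def metricForm {G : Type*} [Group G] (q : G → ℂˣ) (g h : G) : ℂˣ :=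
  q (g * h) * (q g)⁻¹ * (q h)⁻¹

/-- The sum over a finite group of a function factoring through the quotient by `K` is `|K|` times
the sum over the quotient. -/
theorem sum_comp_quotientGroup_mk {A R : Type*} [Group A] [Fintype A] [Semiring R] (K : Subgroup A)
    [Fintype (A ⧸ K)] (f : A ⧸ K → R) :
    ∑ a : A, f (QuotientGroup.mk a) = Nat.card K * ∑ x : A ⧸ K, f x := by
  classical
  have : Fintype K := Fintype.ofFinite K
  rw [Fintype.sum_equiv Subgroup.groupEquivQuotientProdSubgroup
    (fun a : A => f (QuotientGroup.mk a)) (fun p : (A ⧸ K) × K => f p.1) (fun _ => rfl),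
    Fintype.sum_prod_type]
  simp [Finset.mul_sum, Nat.card_eq_fintype_card]

theorem metricForm_comm {G : Type*} [CommGroup G] (q : G → ℂˣ) (g h : G) :
    metricForm q g h = metricForm q h g := by
  simp only [metricForm, mul_comm g h, mul_right_comm]

theorem apply_mul_eq_metricForm {G : Type*} [CommGroup G] (q : G → ℂˣ) (g h : G) :
    q (g * h) = q g * q h * metricForm q g h := by
  rw [metricForm, mul_assoc (q (g * h)), ← mul_inv, mul_comm (q g * q h), inv_mul_cancel_right]

/-- The sum of `b(g, ·)` over a subgroup `H` is `|H|` if `g` is orthogonal to `H`, and `0`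
otherwise. -/
theorem sum_metricForm_subgroup {G : Type*} [CommGroup G] (q : G → ℂˣ)
    (hq : ∀ g₁ g₂ h : G, metricForm q (g₁ * g₂) h = metricForm q g₁ h * metricForm q g₂ h)
    (H : Subgroup G) [Fintype H] (g : G) [Decidable (∀ h ∈ H, metricForm q g h = 1)] :
    ∑ h : H, (metricForm q g h : ℂ) =
      if ∀ h ∈ H, metricForm q g h = 1 then (Fintype.card H : ℂ) else 0 := by
  classical
  let χ : H →* ℂˣ := MonoidHom.mk' (fun h => metricForm q g h) fun a b => by
    simp only [metricForm_comm q g, Subgroup.coe_mul, hq]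
  have key := sum_hom_units ((Units.coeHom ℂ).comp χ)
  have hχ : (Units.coeHom ℂ).comp χ = 1 ↔ ∀ h ∈ H, metricForm q g h = 1 := by
    simp [MonoidHom.ext_iff, χ]
  simp only [hχ, Nat.cast_ite, Nat.cast_zero] at key
  exact key

/-- The Gauss sum of `q` only sees the orthogonal complement of an isotropic subgroup. -/
theorem sum_eq_sum_orthogonal {G : Type*} [CommGroup G] [Fintype G] (q : G → ℂˣ)
    (hq : ∀ g₁ g₂ h : G, metricForm q (g₁ * g₂) h = metricForm q g₁ h * metricForm q g₂ h)
    (H : Subgroup G) (hiso : ∀ h ∈ H, q h = 1)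
    [DecidablePred fun g : G => ∀ h ∈ H, metricForm q g h = 1] :
    ∑ g : G, (q g : ℂ) = ∑ g : G with ∀ h ∈ H, metricForm q g h = 1, (q g : ℂ) := by
  classical
  have : Fintype H := Fintype.ofFinite H
  have hcard : (Fintype.card H : ℂ) ≠ 0 := Nat.cast_ne_zero.mpr Fintype.card_ne_zero
  refine mul_left_cancel₀ hcard ?_
  calc (Fintype.card H : ℂ) * ∑ g : G, (q g : ℂ)
      = ∑ h : H, ∑ g : G, (q (g * h) : ℂ) := by
        have hshift (h : H) : ∑ g : G, (q (g * h) : ℂ) = ∑ g : G, (q g : ℂ) :=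
          Equiv.sum_comp (Equiv.mulRight (h : G)) fun g => (q g : ℂ)
        simp [hshift]
    _ = ∑ g : G, (q g : ℂ) * ∑ h : H, (metricForm q g h : ℂ) := by
        rw [Finset.sum_comm]
        refine Finset.sum_congr rfl fun g _ => ?_
        rw [Finset.mul_sum]
        refine Finset.sum_congr rfl fun h _ => ?_
        simp [apply_mul_eq_metricForm q g h, hiso h h.2]
    _ = (Fintype.card H : ℂ) * ∑ g : G with ∀ h ∈ H, metricForm q g h = 1, (q g : ℂ) := by
        simp only [sum_metricForm_subgroup q hq, Finset.sum_filter, Finset.mul_sum, mul_ite,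
          mul_zero, mul_comm]

/-- For a nondegenerate metric group `(G,q)`, an isotropic subgroup
`H` with orthogonal complement `Hperp`, and the induced form `q̄` on `H^⊥/H`, the
Gauss sums satisfy `∑_{x ∈ H^⊥/H} q̄(x) = |H|⁻¹ · ∑_{g ∈ G} q(g)`. -/
theorem gauss_sum_of_isotropic_quotient
    {G : Type*} [CommGroup G] [Fintype G] (q : G → ℂˣ)
    (hq1 : ∀ g : G, q g⁻¹ = q g)
    (hq2 : ∀ g₁ g₂ h : G, metricForm q (g₁ * g₂) h = metricForm q g₁ h * metricForm q g₂ h)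
    (hnd : ∀ g : G, (∀ h : G, metricForm q g h = 1) → g = 1)
    (H Hperp : Subgroup G)
    (hiso : ∀ h ∈ H, q h = 1)
    (hperp : (Hperp : Set G) = {g : G | ∀ h ∈ H, metricForm q g h = 1})
    [Fintype (↥Hperp ⧸ H.subgroupOf Hperp)]
    (qbar : ↥Hperp ⧸ H.subgroupOf Hperp → ℂˣ)
    (hqbar : ∀ g : ↥Hperp, qbar (QuotientGroup.mk g) = q (g : G)) :
    ∑ x : ↥Hperp ⧸ H.subgroupOf Hperp, (qbar x : ℂ)
      = (Nat.card ↥H : ℂ)⁻¹ * ∑ g : G, (q g : ℂ) := by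
  classical
  have hmem (g : G) : g ∈ Hperp ↔ ∀ h ∈ H, metricForm q g h = 1 := by
    rw [← SetLike.mem_coe, hperp, Set.mem_ofPred_eq]
  have hle : H ≤ Hperp := fun g hg => (hmem g).mpr fun h hh => by
    simp [metricForm, hiso g hg, hiso h hh, hiso _ (H.mul_mem hg hh)]
  have hcard : (Nat.card H : ℂ) ≠ 0 := Nat.cast_ne_zero.mpr Nat.card_pos.ne'
  rw [eq_inv_mul_iff_mul_eq₀ hcard, sum_eq_sum_orthogonal q hq2 H hiso,
    ← Nat.card_congr (Subgroup.subgroupOfEquivOfLe hle).toEquiv,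
    ← sum_comp_quotientGroup_mk _ fun x => (qbar x : ℂ)]
  simp only [hqbar]
  exact (Finset.sum_subtype _ (by simp [hmem]) fun g => (q g : ℂ)).symm
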